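/- arXiv:2107.08797 — 4 statements merged into one kernel-verified Lean document; each statement's English description precedes it below -/
import Mathlib

section
/- Let A be a commutative ring that is a ℚ-algebra, δ : A → A a derivation, and I a differential ideal of A (i.e., δ(I) ⊆ I). Then the radical rad(I) = { a ∈ A | ∃ r ≥ 1, a^r ∈ I } is again a differential ideal: for every a ∈ rad(I) one has δ(a) ∈ rad(I). -/
theorem Derivation.pow_mul_pow_mem_of_pow_succ_mul_pow_mem {R A : Type*} [CommRing R] [CommRing A]
    [Algebra R A] [Algebra ℚ A] (D : Derivation R A A) {I : Ideal A} (hI : ∀ a ∈ I, D a ∈ I)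
    {a : A} {n m : ℕ} (h : a ^ (n + 1) * D a ^ m ∈ I) : a ^ n * D a ^ (m + 2) ∈ I := by
  have hpow : D a * D (D a ^ m) = m * D a ^ m * D (D a) := by
    cases m with
    | zero => simp
    | succ m =>
      simp only [Derivation.leibniz_pow, nsmul_eq_mul, smul_eq_mul, Nat.add_sub_cancel]
      ring
  have hmem : ((n + 1 : ℕ) : A) * (a ^ n * D a ^ (m + 2)) ∈ I := by
    have key : ((n + 1 : ℕ) : A) * (a ^ n * D a ^ (m + 2)) =
        D a * D (a ^ (n + 1) * D a ^ m) - m * D (D a) * (a ^ (n + 1) * D a ^ m) := by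
      simp only [Derivation.leibniz, Derivation.leibniz_pow D a, nsmul_eq_mul, smul_eq_mul,
        Nat.add_sub_cancel]
      linear_combination (-a ^ (n + 1)) * hpow
    rw [key]
    exact I.sub_mem (I.mul_mem_left _ (hI _ h)) (I.mul_mem_left _ h)
  have hunit : IsUnit ((n + 1 : ℕ) : A) := by
    simpa using (IsUnit.mk0 ((n + 1 : ℕ) : ℚ) (by positivity)).map (algebraMap ℚ A)
  exact (I.unit_mul_mem_iff_mem hunit).mp hmem

theorem Derivation.mem_radical_of_mem_radical {R A : Type*} [CommRing R] [CommRing A]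
    [Algebra R A] [Algebra ℚ A] (D : Derivation R A A) {I : Ideal A} (hI : ∀ a ∈ I, D a ∈ I)
    {a : A} (ha : a ∈ I.radical) : D a ∈ I.radical := by
  obtain ⟨n, hn⟩ := ha
  have descend : ∀ n m : ℕ, a ^ n * D a ^ m ∈ I → D a ∈ I.radical := by
    intro n
    induction n with
    | zero => exact fun m h => ⟨m, by simpa using h⟩
    | succ n ih => exact fun m h => ih _ (D.pow_mul_pow_mem_of_pow_succ_mul_pow_mem hI h)
  exact descend n 0 (by simpa using hn)

/-- Lemma 3.2.10: over a commutative `ℚ`-algebra `A` with a derivation `δ`, the radical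
of a differential ideal is again a differential ideal. -/
theorem radical_differential_ideal (A : Type*) [CommRing A] [Algebra ℚ A] (δ : A → A)
    (hδadd : ∀ a b : A, δ (a + b) = δ a + δ b)
    (hδmul : ∀ a b : A, δ (a * b) = a * δ b + b * δ a)
    (I : Ideal A) (hI : ∀ a ∈ I, δ a ∈ I) :
    ∀ a ∈ I.radical, δ a ∈ I.radical := by
  let D : Derivation ℤ A A := Derivation.mk' (AddMonoidHom.mk' δ hδadd).toIntLinearMap hδmul
  exact fun a ha => D.mem_radical_of_mem_radical hI ha
end

section
/- Let A be a commutative ring that is a ℚ-algebra, δ : A → A a derivation, and I a differential ideal of A (i.e., δ(I) ⊆ I). If a ∈ A and r ≥ 1 satisfy a^r ∈ I, then (δ(a))^(2r−1) ∈ I. -/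
namespace Derivation

variable {R A : Type*} [CommRing R] [CommRing A] [Algebra R A]

theorem mul_apply_pow (D : Derivation R A A) (b : A) (n : ℕ) :
    b * D (b ^ n) = n * b ^ n * D b := by
  cases n with
  | zero => simp
  | succ n => simp only [leibniz_pow, Nat.add_sub_cancel, smul_eq_mul, nsmul_eq_mul]; ring

variable [Algebra ℚ A]

theorem pow_mul_apply_mem_of_pow_succ_mem (D : Derivation R A A) {I : Ideal A}
    (hI : ∀ x ∈ I, D x ∈ I) {a : A} {m : ℕ} (h : a ^ (m + 1) ∈ I) : a ^ m * D a ∈ I := by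
  have key := hI _ h
  rw [leibniz_pow, Nat.add_sub_cancel, smul_eq_mul, ← Nat.cast_smul_eq_nsmul ℚ] at key
  simpa [smul_smul, inv_mul_cancel₀ (Nat.cast_add_one_ne_zero (R := ℚ) m)] using
    Submodule.smul_of_tower_mem I ((m + 1 : ℕ) : ℚ)⁻¹ key

theorem pow_mul_pow_add_two_mem (D : Derivation R A A) {I : Ideal A}
    (hI : ∀ x ∈ I, D x ∈ I) {a : A} {m n : ℕ} (h : a ^ (m + 1) * D a ^ n ∈ I) :
    a ^ m * D a ^ (n + 2) ∈ I := by
  have key : ((m + 1 : ℕ) : A) * (a ^ m * D a ^ (n + 2)) ∈ I := by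
    have expand : ((m + 1 : ℕ) : A) * (a ^ m * D a ^ (n + 2)) =
        D a * D (a ^ (m + 1) * D a ^ n) - n * D (D a) * (a ^ (m + 1) * D a ^ n) := by
      simp only [leibniz, leibniz_pow D a (m + 1), Nat.add_sub_cancel, smul_eq_mul, nsmul_eq_mul]
      linear_combination -a ^ (m + 1) * D.mul_apply_pow (D a) n
    rw [expand]
    exact I.sub_mem (I.mul_mem_left _ (hI _ h)) (I.mul_mem_left _ h)
  rw [← nsmul_eq_mul, ← Nat.cast_smul_eq_nsmul ℚ] at key
  simpa [smul_smul, inv_mul_cancel₀ (Nat.cast_add_one_ne_zero (R := ℚ) m)] using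
    Submodule.smul_of_tower_mem I ((m + 1 : ℕ) : ℚ)⁻¹ key

theorem apply_pow_mem_of_pow_mul_pow_mem (D : Derivation R A A) {I : Ideal A}
    (hI : ∀ x ∈ I, D x ∈ I) {a : A} {m n : ℕ} (h : a ^ m * D a ^ n ∈ I) :
    D a ^ (n + 2 * m) ∈ I := by
  induction m generalizing n with
  | zero => simpa using h
  | succ m ih =>
    rw [show n + 2 * (m + 1) = n + 2 + 2 * m by ring]
    exact ih (D.pow_mul_pow_add_two_mem hI h)

end Derivation

/-- The quantitative claim in the proof of Lemma 3.2.10: over a commutative `ℚ`-algebra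
`A` with a derivation `δ` and a differential ideal `I`, if `a ^ r ∈ I` with `r ≥ 1`,
then `(δ a) ^ (2 * r - 1) ∈ I`. -/
theorem pow_deriv_mem_of_pow_mem (A : Type*) [CommRing A] [Algebra ℚ A] (δ : A → A)
    (hδadd : ∀ a b : A, δ (a + b) = δ a + δ b)
    (hδmul : ∀ a b : A, δ (a * b) = a * δ b + b * δ a)
    (I : Ideal A) (hI : ∀ a ∈ I, δ a ∈ I)
    (a : A) (r : ℕ) (hr : 1 ≤ r) (ha : a ^ r ∈ I) :
    (δ a) ^ (2 * r - 1) ∈ I := by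
  let D : Derivation ℤ A A :=
    Derivation.mk' (AddMonoidHom.mk' δ hδadd).toIntLinearMap hδmul
  obtain ⟨m, rfl⟩ := Nat.exists_eq_add_of_le' hr
  have h : a ^ m * D a ^ 1 ∈ I := by
    simpa only [pow_one] using D.pow_mul_apply_mem_of_pow_succ_mem hI ha
  rw [show 2 * (m + 1) - 1 = 1 + 2 * m by lia]
  exact D.apply_pow_mem_of_pow_mul_pow_mem hI h
end

section
/- Let L be a field of characteristic zero, K a subfield of L, and D₁, …, Dₙ pairwise commuting derivations of L each mapping K into K. Then the set K' of all elements of L that are differentially algebraic over K is a subfield of L which contains K and is stable under each D_i (i.e., K' is an intermediate differential field between K and L). -/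
section

variable {L : Type*} [Field L] {n : ℕ}

/-- `D^μ x`: apply `D 1` `μ 1` times, then `D 2` `μ 2` times, …, then `D n` `μ n` times. -/
def iterMulti (D : Fin n → L → L) (μ : Fin n → ℕ) (x : L) : L :=
  (List.finRange n).foldl (fun y i => (D i)^[μ i] y) x

/-- `x` is differentially algebraic over the subfield `K` (w.r.t. the derivations `D`)
if the family of all its derivatives `(D^μ x)_{μ ∈ ℕⁿ}` is algebraically dependent
over `K`. -/
def IsDiffAlgebraic (K : Subfield L) (D : Fin n → L → L) (x : L) : Prop :=
  ¬ AlgebraicIndependent K (fun μ : Fin n → ℕ => iterMulti D μ x)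

theorem List.foldl_iterate_commute {ι α : Type*} {D : ι → α → α}
    (hcomm : ∀ i j, Function.Commute (D i) (D j)) (l : List ι) (μ : ι → ℕ) (i : ι) (x : α) :
    D i (l.foldl (fun y j => (D j)^[μ j] y) x) = l.foldl (fun y j => (D j)^[μ j] y) (D i x) := by
  induction l generalizing x with
  | nil => rfl
  | cons j l ih => rw [foldl_cons, foldl_cons, ih, ((hcomm i j).iterate_right (μ j)).eq]

theorem List.foldl_iterate_add_single {ι α : Type*} [DecidableEq ι] {D : ι → α → α}
    (hcomm : ∀ i j, Function.Commute (D i) (D j)) {l : List ι} (hl : l.Nodup) (μ : ι → ℕ)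
    {i : ι} (hi : i ∈ l) (x : α) :
    l.foldl (fun y j => (D j)^[(μ + Pi.single i 1 : ι → ℕ) j] y) x =
      l.foldl (fun y j => (D j)^[μ j] y) (D i x) := by
  induction l generalizing x with
  | nil => simp at hi
  | cons j l ih =>
    rw [nodup_cons] at hl
    rw [foldl_cons, foldl_cons]
    by_cases hij : i = j
    · subst hij
      rw [Pi.add_apply, Pi.single_eq_same, Function.iterate_succ_apply]
      refine List.foldl_ext _ _ _ fun y k hk => ?_
      have hki : k ≠ i := fun h => hl.1 (h ▸ hk)
      simp [hki]
    · rw [ih hl.2 (by simpa [hij] using hi)]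
      simp [Ne.symm hij, ((hcomm i j).iterate_right (μ j)).eq]

theorem iterMulti_zero {α : Type*} (D : Fin n → α → α) (x : α) : iterMulti D 0 x = x := by
  unfold iterMulti
  induction List.finRange n with
  | nil => rfl
  | cons i l ih => simp

theorem iterMulti_add_single {α : Type*} {D : Fin n → α → α}
    (hcomm : ∀ i j, Function.Commute (D i) (D j)) (μ : Fin n → ℕ) (i : Fin n) (x : α) :
    iterMulti D (μ + Pi.single i 1) x = D i (iterMulti D μ x) := by
  unfold iterMulti
  rw [List.foldl_iterate_commute hcomm,
    List.foldl_iterate_add_single hcomm (List.nodup_finRange n) μ (List.mem_finRange i)]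

open AlgebraicIndependent

/-- The field of elements of `L` algebraic over `K(S)`. -/
def relAlgClosure (K : Subfield L) (S : Set L) : Subfield L where
  __ := (Subalgebra.algebraicClosure (Algebra.adjoin K S) L).toSubring
  inv_mem' _ hx := IsAlgebraic.inv hx

theorem mem_relAlgClosure {K : Subfield L} {S : Set L} {x : L} :
    x ∈ relAlgClosure K S ↔ IsAlgebraic (Algebra.adjoin K S) x := Iff.rfl

theorem coe_relAlgClosure (K : Subfield L) (S : Set L) :
    (relAlgClosure K S : Set L) = (matroid K L).closure S := by
  rw [matroid_closure_eq]; rfl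

theorem subset_relAlgClosure (K : Subfield L) (S : Set L) : S ⊆ relAlgClosure K S := by
  rw [coe_relAlgClosure]
  exact Matroid.subset_closure _ _ (Set.subset_univ _)

theorem le_relAlgClosure (K : Subfield L) (S : Set L) : K ≤ relAlgClosure K S := fun a ha =>
  mem_relAlgClosure.2 (isAlgebraic_algebraMap (algebraMap K (Algebra.adjoin K S) ⟨a, ha⟩))

theorem relAlgClosure_mono (K : Subfield L) {S T : Set L} (h : S ⊆ T) :
    relAlgClosure K S ≤ relAlgClosure K T := by
  rw [← SetLike.coe_subset_coe, coe_relAlgClosure, coe_relAlgClosure]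
  exact Matroid.closure_subset_closure _ h

theorem relAlgClosure_le {K : Subfield L} {S T : Set L} (h : S ⊆ relAlgClosure K T) :
    relAlgClosure K S ≤ relAlgClosure K T := by
  rw [← SetLike.coe_subset_coe, coe_relAlgClosure, coe_relAlgClosure]
  rw [coe_relAlgClosure] at h
  exact Matroid.closure_subset_closure_of_subset_closure h

/-- Derivatives of elements algebraic over `K(S)` are algebraic over `K(S, D S)`. -/
theorem Derivation.map_mem_relAlgClosure [CharZero L] {K : Subfield L} (D : Derivation ℤ L L)
    (hK : ∀ a ∈ K, D a ∈ K) {S T : Set L} (hST : S ⊆ relAlgClosure K T)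
    (hD : ∀ s ∈ S, D s ∈ relAlgClosure K T) {a : L} (ha : a ∈ relAlgClosure K S) :
    D a ∈ relAlgClosure K T := by
  set F := relAlgClosure K T
  set A := Algebra.adjoin K S
  have haF : a ∈ F := relAlgClosure_le hST ha
  have hAF : ∀ b : A, (b : L) ∈ F := fun b =>
    relAlgClosure_le hST (mem_relAlgClosure.2 (isAlgebraic_algebraMap b))
  have hDA : ∀ b : A, D b ∈ F := by
    rintro ⟨b, hb⟩
    induction hb using Algebra.adjoin_induction with
    | mem x hx => exact hD x hx
    | algebraMap r => exact le_relAlgClosure K T (hK r r.2)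
    | add x y hx hy ihx ihy => simpa using add_mem ihx ihy
    | mul x y hx hy ihx ihy =>
      simpa using add_mem (mul_mem (hAF ⟨x, hx⟩) ihy) (mul_mem (hAF ⟨y, hy⟩) ihx)
  have haeval : ∀ p : Polynomial A, Polynomial.aeval a p ∈ F := fun p => by
    rw [Polynomial.aeval_eq_sum_range]
    exact sum_mem fun i _ => by
      rw [Algebra.smul_def]; exact mul_mem (hAF _) (pow_mem haF i)
  have hchain : ∀ p : Polynomial A,
      D (Polynomial.aeval a p) - Polynomial.aeval a p.derivative * D a ∈ F := by
    intro p
    induction p using Polynomial.induction_on' with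
    | add p q hp hq =>
      convert! add_mem hp hq using 1
      simp only [map_add]
      ring
    | monomial k b =>
      have hk : algebraMap A L k = k := _root_.map_natCast (algebraMap A L) k
      convert! mul_mem (pow_mem haF k) (hDA b) using 1
      simp only [Polynomial.aeval_monomial, Polynomial.derivative_monomial, Derivation.leibniz,
        Derivation.leibniz_pow, smul_eq_mul, nsmul_eq_mul, map_mul, hk]
      change _ + a ^ k * D (b : L) - _ = _
      ring
  obtain ⟨p, hp0, hp⟩ := ha
  induction hd : p.natDegree using Nat.strong_induction_on generalizing p with
  | _ d ih =>
    by_cases h' : Polynomial.aeval a p.derivative = 0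
    · have hpos : p.natDegree ≠ 0 := fun h => by
        rw [Polynomial.eq_C_of_natDegree_eq_zero h] at hp hp0
        simp only [Polynomial.aeval_C] at hp
        exact hp0 (by
          rw [(FaithfulSMul.algebraMap_eq_zero_iff A L).1 hp, map_zero])
      exact ih _ (hd ▸ Polynomial.natDegree_derivative_lt hpos) p.derivative
        (fun h => hpos (Polynomial.derivative_eq_zero.1 h)) h' rfl
    · have := hchain p
      rw [hp, map_zero, zero_sub, neg_mem_iff] at this
      simpa [h'] using mul_mem (inv_mem (haeval p.derivative)) this

theorem exists_mem_relAlgClosure_image_Iio {ι : Type*} [LinearOrder ι] {K : Subfield L}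
    {v : ι → L} (hv : ¬ AlgebraicIndependent K v) :
    ∃ i, v i ∈ relAlgClosure K (v '' Set.Iio i) := by
  by_contra! h
  refine hv (algebraicIndependent_of_finite_type fun t ht => ?_)
  lift t to Finset ι using ht
  change AlgebraicIndepOn K v t
  induction t using Finset.induction_on_max with
  | empty =>
    rw [Finset.coe_empty]
    exact algebraicIndependent_empty_type_iff.2 (FaithfulSMul.algebraMap_injective K L)
  | insert i t hi ih =>
    rw [Finset.coe_insert]
    exact ih.insert fun h' => h i
      (relAlgClosure_mono K (Set.image_mono hi) (mem_relAlgClosure.2 h'))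

@[elab_as_elim]
theorem Finsupp.induction_add_single_one {σ : Type*} {motive : (σ →₀ ℕ) → Prop} (μ : σ →₀ ℕ)
    (zero : motive 0) (add_single : ∀ μ i, motive μ → motive (μ + Finsupp.single i 1)) :
    motive μ := by
  suffices h : ∀ ν, motive ν → motive (ν + μ) by simpa using h 0 zero
  induction μ using Finsupp.induction_linear with
  | zero => simp
  | add f g hf hg => exact fun ν hν => add_assoc ν f g ▸ hg _ (hf _ hν)
  | single i k =>
    intro ν hν
    induction k with
    | zero => simpa using hν
    | succ k ih => rw [Finsupp.single_add, ← add_assoc]; exact add_single _ _ ih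

/-- The multi-indices of order at most `r`. -/
noncomputable def degreeBall (n r : ℕ) : Finset (Fin n →₀ ℕ) :=
  (Finset.Iic (Finsupp.equivFunOnFinite.symm fun _ => r)).filter fun μ => μ.degree ≤ r

theorem mem_degreeBall {n r : ℕ} {μ : Fin n →₀ ℕ} : μ ∈ degreeBall n r ↔ μ.degree ≤ r := by
  simp only [degreeBall, Finset.mem_filter, Finset.mem_Iic, and_iff_right_iff_imp]
  exact fun h i => (Finsupp.le_degree i μ).trans h

theorem degreeBall_mono (n : ℕ) : Monotone (degreeBall n) := fun _ _ h _ hμ =>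
  mem_degreeBall.2 ((mem_degreeBall.1 hμ).trans h)

theorem card_degreeBall_le (n r : ℕ) : (degreeBall n r).card ≤ (r + 1) ^ n := by
  refine (Finset.card_filter_le _ _).trans ?_
  rw [Finsupp.card_Iic]
  refine (Finset.prod_le_prod_of_subset_of_one_le' (Finset.subset_univ _) ?_).trans ?_ <;> simp

theorem card_degreeBall_pos (n r : ℕ) : 0 < (degreeBall n r).card :=
  Finset.card_pos.2 ⟨0, mem_degreeBall.2 (by simp)⟩

/-- Translating by `ν` bounds the number of multi-indices not above `ν`. -/
theorem card_degreeBall_add_card_filter_le {n : ℕ} (r : ℕ) {c : ℕ} {ν : Fin n →₀ ℕ}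
    (hc : ν.degree ≤ c) :
    (degreeBall n r).card + ((degreeBall n (r + c)).filter fun μ => ¬ ν ≤ μ).card ≤
      (degreeBall n (r + c)).card := by
  classical
  rw [← Finset.card_filter_add_card_filter_not (s := degreeBall n (r + c)) (fun μ => ν ≤ μ)]
  refine Nat.add_le_add_right ?_ _
  refine Finset.card_le_card_of_injOn (ν + ·) (fun μ hμ => ?_) (add_right_injective ν).injOn
  have := mem_degreeBall.1 hμ
  simp only [Finset.coe_filter, Set.mem_ofPred_eq, mem_degreeBall, map_add]
  exact ⟨by omega, le_self_add⟩

theorem exists_mul_card_degreeBall_lt (n c : ℕ) :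
    ∃ r, 2 * (degreeBall n (r + c)).card < 3 * (degreeBall n r).card := by
  by_contra! h
  have hgrowth : ∀ k : ℕ, 3 ^ k ≤ 2 ^ k * (degreeBall n (k * c)).card := fun k => by
    induction k with
    | zero => simpa using card_degreeBall_pos n (0 * c)
    | succ k ih =>
      have := h (k * c)
      rw [Nat.succ_mul, pow_succ, pow_succ]
      nlinarith [Nat.pow_pos (n := k) (show 0 < 2 by norm_num)]
  have hlim := (tendsto_pow_const_div_const_pow_of_one_lt n (show (1 : ℝ) < 3 / 2 by norm_num))
  have hlim' := hlim.const_mul (((c : ℝ) + 1) ^ n)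
  rw [mul_zero] at hlim'
  obtain ⟨k, hk, hk1⟩ := ((hlim'.eventually_lt_const one_pos).and
    (Filter.eventually_ge_atTop 1)).exists
  have hle : (degreeBall n (k * c)).card ≤ ((c + 1) * k) ^ n :=
    (card_degreeBall_le n _).trans (Nat.pow_le_pow_left (by nlinarith) n)
  have hreal : (3 : ℝ) ^ k ≤ 2 ^ k * ((c + 1) * k) ^ n := by
    exact_mod_cast (hgrowth k).trans (Nat.mul_le_mul_left _ hle)
  rw [← mul_div_assoc, div_lt_one (by positivity), div_pow, lt_div_iff₀ (by positivity),
    ← mul_pow] at hk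
  linarith

theorem iterMulti_add_finsupp_single {α : Type*} {D : Fin n → α → α}
    (hcomm : ∀ i j, Function.Commute (D i) (D j)) (μ : Fin n →₀ ℕ) (i : Fin n) (x : α) :
    iterMulti D (μ + Finsupp.single i 1 : Fin n →₀ ℕ) x =
      D i (iterMulti D μ x) := by
  rw [Finsupp.coe_add, Finsupp.single_eq_pi_single, iterMulti_add_single hcomm]

theorem isDiffAlgebraic_of_mem {K : Subfield L} {D : Fin n → L → L} {a : L} (ha : a ∈ K) :
    IsDiffAlgebraic K D a := fun h =>
  h.transcendental 0 (by
    rw [iterMulti_zero]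
    exact isAlgebraic_algebraMap (⟨a, ha⟩ : K))

theorem AlgebraicIndependent.card_le_of_forall_mem_relAlgClosure {ι : Type*} {K : Subfield L}
    {v : ι → L} (hv : AlgebraicIndependent K v) {s : Finset ι} {T : Finset L}
    (h : ∀ i ∈ s, v i ∈ relAlgClosure K (T : Set L)) : s.card ≤ T.card := by
  have hind : (matroid K L).Indep (v '' s) := by
    have hrange : (matroid K L).Indep (Set.range (v ∘ ((↑) : s → ι))) :=
      (hv.comp _ Subtype.val_injective).coe_range
    rwa [Set.range_comp, Subtype.range_coe] at hrange
  have hle := hind.encard_le_eRk_of_subset (X := (matroid K L).closure (T : Set L)) (by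
    rintro _ ⟨i, hi, rfl⟩
    rw [← coe_relAlgClosure]
    exact h i hi)
  rw [Matroid.eRk_closure_eq, hv.injective.injOn.encard_image, Set.encard_coe_eq_coe_finsetCard]
    at hle
  have := hle.trans (Matroid.eRk_le_encard _ _)
  rw [Set.encard_coe_eq_coe_finsetCard] at this
  exact_mod_cast this

section

variable [CharZero L] {K : Subfield L} {D : Fin n → Derivation ℤ L L}

open MonomialOrder

/-- All derivatives of order at most `r` of a differentially algebraic element are algebraic over
those whose multi-index is not above a fixed one. -/
theorem IsDiffAlgebraic.exists_iterMulti_mem_relAlgClosure {x : L}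
    (hx : IsDiffAlgebraic K (fun i => D i) x) (hcomm : ∀ i j, Function.Commute (D i) (D j))
    (hK : ∀ i, ∀ a ∈ K, D i a ∈ K) :
    ∃ ν : Fin n →₀ ℕ, ∀ r : ℕ, ∀ μ ∈ degreeBall n r, iterMulti (fun i => D i) μ x ∈
      relAlgClosure K ((fun μ : Fin n →₀ ℕ => iterMulti (fun i => D i) μ x) ''
        ((degreeBall n r).filter fun μ => ¬ ν ≤ μ)) := by
  set v : (Fin n →₀ ℕ) → L := fun μ => iterMulti (fun i => D i) μ x
  have hind : ¬ AlgebraicIndependent K (v ∘ degLex.toSyn.symm) := by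
    rwa [IsDiffAlgebraic, ← algebraicIndependent_equiv (degLex.toSyn.symm.toEquiv.trans
      Finsupp.equivFunOnFinite)] at hx
  obtain ⟨s, hs⟩ := exists_mem_relAlgClosure_image_Iio hind
  obtain ⟨ν, rfl⟩ := degLex.toSyn.surjective s
  have himage : ∀ μ : Fin n →₀ ℕ, v ∘ degLex.toSyn.symm '' Set.Iio (degLex.toSyn μ) =
      v '' {κ | κ ≺[degLex] μ} := fun μ => by
    rw [Set.image_comp, show ⇑degLex.toSyn.symm '' Set.Iio (degLex.toSyn μ) = _ from
      degLex.toSyn.toEquiv.image_symm_eq_preimage _]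
    rfl
  have hup : ∀ α : Fin n →₀ ℕ, v (ν + α) ∈ relAlgClosure K (v '' {κ | κ ≺[degLex] ν + α}) := by
    intro α
    induction α using Finsupp.induction_add_single_one with
    | zero =>
      rw [himage] at hs
      simpa using hs
    | add_single α i ih =>
      have hlt : ν + α ≺[degLex] ν + (α + Finsupp.single i 1) := by
        rw [← add_assoc, map_add _ (ν + α)]
        exact lt_add_of_pos_right _ (degLex.toSyn_lt_iff_ne_zero.2 (by simp))
      have hv' : v (ν + (α + Finsupp.single i 1)) = D i (v (ν + α)) := by
        rw [← add_assoc]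
        exact iterMulti_add_finsupp_single hcomm _ i x
      rw [hv']
      refine (D i).map_mem_relAlgClosure (hK i) ?_ ?_ ih
      · exact (Set.image_mono fun κ hκ => lt_trans hκ hlt).trans (subset_relAlgClosure K _)
      · rintro _ ⟨κ, hκ, rfl⟩
        refine subset_relAlgClosure K _ ⟨κ + Finsupp.single i 1, ?_, ?_⟩
        · change degLex.toSyn _ < degLex.toSyn _
          rw [← add_assoc, map_add, map_add _ (ν + α)]
          exact add_lt_add_left hκ _
        · exact iterMulti_add_finsupp_single hcomm κ i x
  refine ⟨ν, fun r μ hμ => ?_⟩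
  induction hs : degLex.toSyn μ using WellFoundedLT.induction generalizing μ with
  | _ s ih =>
  subst hs
  by_cases h : ν ≤ μ
  · obtain ⟨α, rfl⟩ := exists_add_of_le h
    refine relAlgClosure_le ?_ (hup α)
    rintro _ ⟨κ, hκ, rfl⟩
    refine ih _ hκ κ ?_ rfl
    exact mem_degreeBall.2 ((Finsupp.DegLex.monotone_degree hκ.le).trans (mem_degreeBall.1 hμ))
  · exact subset_relAlgClosure K _ ⟨μ, by simp [hμ, h], rfl⟩

theorem iterMulti_mem_relAlgClosure_of_mem (hcomm : ∀ i j, Function.Commute (D i) (D j))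
    (hK : ∀ i, ∀ a ∈ K, D i a ∈ K) {x y z : L} {s : ℕ}
    (hz : z ∈ relAlgClosure K
      ((fun μ : Fin n →₀ ℕ => iterMulti (fun i => D i) μ x) '' degreeBall n s ∪
        (fun μ : Fin n →₀ ℕ => iterMulti (fun i => D i) μ y) '' degreeBall n s))
    (μ : Fin n →₀ ℕ) :
    iterMulti (fun i => D i) μ z ∈ relAlgClosure K
      ((fun μ : Fin n →₀ ℕ => iterMulti (fun i => D i) μ x) '' degreeBall n (μ.degree + s) ∪
        (fun μ : Fin n →₀ ℕ => iterMulti (fun i => D i) μ y) '' degreeBall n (μ.degree + s)) := by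
  have hstep : ∀ (w : L) (r : ℕ) (i : Fin n), ∀ a ∈
      (fun μ : Fin n →₀ ℕ => iterMulti (fun i => D i) μ w) '' degreeBall n r,
      D i a ∈ (fun μ : Fin n →₀ ℕ => iterMulti (fun i => D i) μ w) '' degreeBall n (r + 1) := by
    rintro w r i _ ⟨κ, hκ, rfl⟩
    refine ⟨κ + Finsupp.single i 1, ?_, iterMulti_add_finsupp_single hcomm κ i w⟩
    simpa [mem_degreeBall] using hκ
  induction μ using Finsupp.induction_add_single_one with
  | zero => simpa [iterMulti_zero] using hz
  | add_single μ i ih =>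
    rw [iterMulti_add_finsupp_single hcomm, map_add, Finsupp.degree_single, add_right_comm]
    refine (D i).map_mem_relAlgClosure (hK i) ?_ ?_ ih
    · refine (Set.union_subset_union ?_ ?_).trans (subset_relAlgClosure K _) <;>
        exact Set.image_mono (Finset.coe_subset.2 (degreeBall_mono n (Nat.le_succ _)))
    · rintro a (ha | ha)
      · exact subset_relAlgClosure K _ (Or.inl (hstep x _ i a ha))
      · exact subset_relAlgClosure K _ (Or.inr (hstep y _ i a ha))

/-- An element algebraic over finitely many derivatives of two differentially algebraic elements
is differentially algebraic. -/
theorem IsDiffAlgebraic.of_mem_relAlgClosure {x y z : L} {s : ℕ}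
    (hx : IsDiffAlgebraic K (fun i => D i) x) (hy : IsDiffAlgebraic K (fun i => D i) y)
    (hcomm : ∀ i j, Function.Commute (D i) (D j)) (hK : ∀ i, ∀ a ∈ K, D i a ∈ K)
    (hz : z ∈ relAlgClosure K
      ((fun μ : Fin n →₀ ℕ => iterMulti (fun i => D i) μ x) '' degreeBall n s ∪
        (fun μ : Fin n →₀ ℕ => iterMulti (fun i => D i) μ y) '' degreeBall n s)) :
    IsDiffAlgebraic K (fun i => D i) z := by
  intro hind
  obtain ⟨ν, hν⟩ := hx.exists_iterMulti_mem_relAlgClosure hcomm hK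
  obtain ⟨ξ, hξ⟩ := hy.exists_iterMulti_mem_relAlgClosure hcomm hK
  set c := max s (max ν.degree ξ.degree)
  obtain ⟨r, hr⟩ := exists_mul_card_degreeBall_lt n c
  set A := (degreeBall n (r + c)).filter fun μ => ¬ ν ≤ μ
  set B := (degreeBall n (r + c)).filter fun μ => ¬ ξ ≤ μ
  have hcard : (degreeBall n r).card ≤ A.card + B.card := by
    classical
    refine (AlgebraicIndependent.card_le_of_forall_mem_relAlgClosure
      (hind.comp _ DFunLike.coe_injective)
      (T := A.image (fun μ : Fin n →₀ ℕ => iterMulti (fun i => D i) μ x) ∪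
        B.image (fun μ : Fin n →₀ ℕ => iterMulti (fun i => D i) μ y)) fun μ hμ => ?_).trans
      ((Finset.card_union_le _ _).trans
        (Nat.add_le_add Finset.card_image_le Finset.card_image_le))
    refine relAlgClosure_le ?_ (iterMulti_mem_relAlgClosure_of_mem hcomm hK hz μ)
    have hdeg : μ.degree + s ≤ r + c :=
      Nat.add_le_add (mem_degreeBall.1 hμ) (le_max_left _ _)
    rw [Finset.coe_union, Finset.coe_image, Finset.coe_image]
    rintro _ (⟨κ, hκ, rfl⟩ | ⟨κ, hκ, rfl⟩)
    · exact relAlgClosure_mono K Set.subset_union_left (hν _ κ (degreeBall_mono n hdeg hκ))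
    · exact relAlgClosure_mono K Set.subset_union_right (hξ _ κ (degreeBall_mono n hdeg hκ))
  have h₁ : _ + A.card ≤ _ :=
    card_degreeBall_add_card_filter_le r (c := c) (ν := ν) (by omega)
  have h₂ : _ + B.card ≤ _ :=
    card_degreeBall_add_card_filter_le r (c := c) (ν := ξ) (by omega)
  omega

end

/-- Definition 3.2.18: the differentially algebraic elements of `L` over `K` form an
intermediate differential field: a subfield of `L` containing `K` and stable under
each derivation `D i`. -/
theorem diffAlgebraicClosure_is_differential_subfield [CharZero L] (K : Subfield L)
    (D : Fin n → L → L)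
    (hadd : ∀ i, ∀ a b : L, D i (a + b) = D i a + D i b)
    (hleib : ∀ i, ∀ a b : L, D i (a * b) = a * D i b + b * D i a)
    (hcomm : ∀ i j, ∀ a : L, D i (D j a) = D j (D i a))
    (hK : ∀ i, ∀ a ∈ K, D i a ∈ K) :
    ∃ K' : Subfield L, (∀ x : L, x ∈ K' ↔ IsDiffAlgebraic K D x) ∧
      K ≤ K' ∧ ∀ i, ∀ x ∈ K', D i x ∈ K' := by
  obtain ⟨D, rfl⟩ : ∃ D' : Fin n → Derivation ℤ L L, D = fun i => ⇑(D' i) :=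
    ⟨fun i => Derivation.mk' (AddMonoidHom.mk' (D i) (hadd i)).toIntLinearMap (hleib i), rfl⟩
  have hmem : ∀ w : L, w ∈ (fun μ : Fin n →₀ ℕ => iterMulti (fun i => D i) μ w) ''
      degreeBall n 1 := fun w =>
    ⟨0, by simp [mem_degreeBall], iterMulti_zero _ w⟩
  have hmap : ∀ (i : Fin n) (w : L),
      D i w ∈ (fun μ : Fin n →₀ ℕ => iterMulti (fun i => D i) μ w) '' degreeBall n 1 :=
    fun i w => ⟨Finsupp.single i 1, by simp [mem_degreeBall], by
      simpa [iterMulti_zero] using iterMulti_add_finsupp_single hcomm 0 i w⟩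
  have hleft : ∀ {w x y : L},
      w ∈ (fun μ : Fin n →₀ ℕ => iterMulti (fun i => D i) μ x) '' degreeBall n 1 →
      w ∈ relAlgClosure K
        ((fun μ : Fin n →₀ ℕ => iterMulti (fun i => D i) μ x) '' degreeBall n 1 ∪
          (fun μ : Fin n →₀ ℕ => iterMulti (fun i => D i) μ y) '' degreeBall n 1) :=
    fun hw => subset_relAlgClosure K _ (Or.inl hw)
  have hright : ∀ x y : L, y ∈ relAlgClosure K
      ((fun μ : Fin n →₀ ℕ => iterMulti (fun i => D i) μ x) '' degreeBall n 1 ∪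
        (fun μ : Fin n →₀ ℕ => iterMulti (fun i => D i) μ y) '' degreeBall n 1) :=
    fun x y => subset_relAlgClosure K _ (Or.inr (hmem y))
  refine ⟨{ carrier := {x | IsDiffAlgebraic K (fun i => D i) x}
            zero_mem' := isDiffAlgebraic_of_mem K.zero_mem
            one_mem' := isDiffAlgebraic_of_mem K.one_mem
            add_mem' := fun {x y} hx hy => hx.of_mem_relAlgClosure hy hcomm hK
              (add_mem (hleft (hmem x)) (hright x y))
            mul_mem' := fun {x y} hx hy => hx.of_mem_relAlgClosure hy hcomm hK
              (mul_mem (hleft (hmem x)) (hright x y))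
            neg_mem' := fun {x} hx => hx.of_mem_relAlgClosure hx hcomm hK
              (neg_mem (hright x x))
            inv_mem' := fun x hx => IsDiffAlgebraic.of_mem_relAlgClosure hx hx hcomm hK
              (inv_mem (hright x x)) }, fun x => Iff.rfl, fun a ha => isDiffAlgebraic_of_mem ha,
    fun i x hx => IsDiffAlgebraic.of_mem_relAlgClosure hx hx hcomm hK (hleft (hmap i x))⟩

end
end

section
/- Let R be the polynomial ring over ℚ in the variables y_μ indexed by multi-indices μ ∈ ℕ² (formally, MvPolynomial (Fin 2 →₀ ℕ) ℚ), and let d₁, d₂ : R → R be the unique ℚ-derivations with d_i(y_μ) = y_{μ + 1_i}, where 1_i is the i-th unit multi-index. Let P₁ = y_{(0,2)} − (1/2)·(y_{(2,0)})² and P₂ = y_{(1,1)} − y_{(2,0)} (corresponding to y₂₂ − ½(y₁₁)² and y₁₂ − y₁₁), and let 𝔞 be the ideal of R generated by all iterated derivatives d_{i₁} ∘ ⋯ ∘ d_{i_k} applied to P₁ and P₂ for arbitrary finite words (i₁,…,i_k) in {1,2} (the differential ideal generated by P₁, P₂). Then y_{(3,0)} (corresponding to y₁₁₁) lies in the radical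 of 𝔞. -/
open MvPolynomial

/-- The formal derivations `d₁, d₂` on the differential polynomial ring
`ℚ{y} = ℚ[y_μ : μ ∈ ℕ²]` with `d_i y_μ = y_{μ + 1_i}`. -/
noncomputable def formalPDeriv (i : Fin 2) :
    Derivation ℚ (MvPolynomial (Fin 2 →₀ ℕ) ℚ) (MvPolynomial (Fin 2 →₀ ℕ) ℚ) :=
  mkDerivation ℚ (fun μ => X (μ + Finsupp.single i 1))

/-- `d_{i₁} ∘ ⋯ ∘ d_{i_k}` applied to `p`, for a word `w = (i₁, …, i_k)` in `{1, 2}`. -/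
noncomputable def applyWord (w : List (Fin 2)) (p : MvPolynomial (Fin 2 →₀ ℕ) ℚ) :
    MvPolynomial (Fin 2 →₀ ℕ) ℚ :=
  w.foldr (fun i q => formalPDeriv i q) p

theorem formalPDeriv_X (i : Fin 2) (μ : Fin 2 →₀ ℕ) :
    formalPDeriv i (X μ) = X (μ + Finsupp.single i 1) :=
  mkDerivation_X _ _ _

/-- Example 3.2.7 (PD 1): for the differential ideal `𝔞` of `ℚ{y}` generated by
`P₁ = y₍₀,₂₎ − ½ y₍₂,₀₎²` (i.e. `y₂₂ − ½ (y₁₁)²`) and `P₂ = y₍₁,₁₎ − y₍₂,₀₎`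
(i.e. `y₁₂ − y₁₁`), the element `y₍₃,₀₎` (i.e. `y₁₁₁`) lies in `rad 𝔞`. -/
theorem y111_mem_radical_pd1 :
    X (Finsupp.single 0 3) ∈ (Ideal.span
      { q : MvPolynomial (Fin 2 →₀ ℕ) ℚ | ∃ w : List (Fin 2),
          q = applyWord w
              (X (Finsupp.single 1 2) - C (1/2 : ℚ) * X (Finsupp.single 0 2) ^ 2) ∨
          q = applyWord w
              (X (Finsupp.single 0 1 + Finsupp.single 1 1) - X (Finsupp.single 0 2)) }).radical := by
  refine ⟨3, ?_⟩
  set P₁ : MvPolynomial (Fin 2 →₀ ℕ) ℚ :=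
    X (Finsupp.single 1 2) - C (1/2 : ℚ) * X (Finsupp.single 0 2) ^ 2 with hP₁
  set P₂ : MvPolynomial (Fin 2 →₀ ℕ) ℚ :=
    X (Finsupp.single 0 1 + Finsupp.single 1 1) - X (Finsupp.single 0 2) with hP₂
  set 𝔞 := Ideal.span { q | ∃ w : List (Fin 2), q = applyWord w P₁ ∨ q = applyWord w P₂ }
  have mem₁ (w : List (Fin 2)) : applyWord w P₁ ∈ 𝔞 := Ideal.subset_span ⟨w, .inl rfl⟩
  have mem₂ (w : List (Fin 2)) : applyWord w P₂ ∈ 𝔞 := Ideal.subset_span ⟨w, .inr rfl⟩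
  have hC : (C (1/2 : ℚ) : MvPolynomial (Fin 2 →₀ ℕ) ℚ) * 2 = 1 := by
    rw [← map_ofNat C 2, ← C_mul]
    norm_num
  -- The crossed derivative reduces to `y₁₁₁ - y₁₁ y₁₁₁`.
  have crossed : formalPDeriv 0 P₁ - formalPDeriv 1 P₂ - formalPDeriv 0 P₂ =
      X (Finsupp.single 0 3) - X (Finsupp.single 0 2) * X (Finsupp.single 0 3) := by
    have h₁ : (Finsupp.single 0 1 + Finsupp.single 1 1 + Finsupp.single 1 1 : Fin 2 →₀ ℕ) =
        Finsupp.single 1 2 + Finsupp.single 0 1 := by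
      rw [add_assoc, ← Finsupp.single_add, add_comm]
    have h₂ : (Finsupp.single 0 1 + Finsupp.single 1 1 + Finsupp.single 0 1 : Fin 2 →₀ ℕ) =
        Finsupp.single 0 2 + Finsupp.single 1 1 := by
      rw [add_right_comm, ← Finsupp.single_add]
    simp only [hP₁, hP₂, map_sub, Derivation.leibniz, Derivation.leibniz_pow, derivation_C,
      formalPDeriv_X, h₁, h₂, ← Finsupp.single_add, smul_eq_mul, nsmul_eq_mul]
    norm_num
    linear_combination (X (Finsupp.single 0 2) * X (Finsupp.single 0 3)) * hC
  have crossed_mem :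
      formalPDeriv 0 P₁ - formalPDeriv 1 P₂ - formalPDeriv 0 P₂ ∈ 𝔞 :=
    sub_mem (sub_mem (mem₁ [0]) (mem₂ [1])) (mem₂ [0])
  have deriv_crossed_mem :
      formalPDeriv 0 (formalPDeriv 0 P₁ - formalPDeriv 1 P₂ - formalPDeriv 0 P₂) ∈ 𝔞 := by
    rw [map_sub, map_sub]
    exact sub_mem (sub_mem (mem₁ [0, 0]) (mem₂ [0, 1])) (mem₂ [0, 0])
  rw [crossed] at crossed_mem deriv_crossed_mem
  simp only [map_sub, Derivation.leibniz, formalPDeriv_X, ← Finsupp.single_add,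
    smul_eq_mul, Nat.reduceAdd] at deriv_crossed_mem
  convert sub_mem (𝔞.mul_mem_left (X (Finsupp.single 0 4)) crossed_mem)
    (𝔞.mul_mem_left (X (Finsupp.single 0 3)) deriv_crossed_mem) using 1
  ring
end
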